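/- For every m×m unitary matrix U and every m×m Hermitian matrix Z, the Hilbert–Schmidt projection onto the set of density matrices is unitarily equivariant: π_{S_m}(U⁻¹ Z U) = U⁻¹ π_{S_m}(Z) U. -/

import Mathlib

open scoped BigOperators ENNReal
open MeasureTheory ProbabilityTheory Matrix
open scoped ComplexOrder

noncomputable section

abbrev Mat (m : ℕ) := Matrix (Fin m) (Fin m) ℂ

namespace QST

variable {m : ℕ}

/-- Hilbert–Schmidt (Frobenius) norm `‖A‖₂`. -/
def frob (A : Mat m) : ℝ := Real.sqrt (∑ i, ∑ j, ‖A i j‖ ^ 2)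

/-- Hilbert–Schmidt inner product `⟨A,B⟩ = Re tr(A B*)`. -/
def hsInner (A B : Mat m) : ℝ := (Matrix.trace (A * Bᴴ)).re

/-- Eigenvalues of a Hermitian matrix (junk value `0` otherwise). -/
def eigs (A : Mat m) : Fin m → ℝ :=
  if h : A.IsHermitian then h.eigenvalues else 0

/-- Operator (spectral) norm of a Hermitian matrix: the largest absolute value
of an eigenvalue. -/
def opNorm (A : Mat m) : ℝ := ⨆ i, |eigs A i|

/-- Schatten `p`-norm, `p ∈ [1,∞]`. -/
def schatten (p : ℝ≥0∞) (A : Mat m) : ℝ :=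
  if p = ∞ then opNorm A
  else (∑ i, |eigs A i| ^ p.toReal) ^ (1 / p.toReal)

/-- A density matrix: positive semidefinite (hence Hermitian) with unit trace. -/
def IsDensity (A : Mat m) : Prop := A.PosSemidef ∧ A.trace = 1

/-- The set `𝒮_m` of density matrices. -/
def Densities (m : ℕ) : Set (Mat m) := {A | IsDensity A}

/-- The set `𝒮_{m,δ} = {(1-δ) S + δ I/m : S ∈ 𝒮_m}`. -/
def DensitiesReg (m : ℕ) (δ : ℝ) : Set (Mat m) :=
  {A | ∃ S, IsDensity S ∧ A = (1 - δ) • S + (δ / m) • (1 : Mat m)}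

/-- `P` is the Hilbert–Schmidt projection of `Z` onto the set `C`. -/
def IsProjOn (C : Set (Mat m)) (Z P : Mat m) : Prop :=
  P ∈ C ∧ ∀ S ∈ C, frob (Z - P) ≤ frob (Z - S)

/-- Functional calculus for Hermitian matrices via the spectral decomposition
(junk value `0` for non-Hermitian matrices). -/
def hermApply (f : ℝ → ℝ) (A : Mat m) : Mat m :=
  if h : A.IsHermitian then
    (h.eigenvectorUnitary : Mat m) *
      Matrix.diagonal (fun i => (f (h.eigenvalues i) : ℂ)) *
        (star (h.eigenvectorUnitary : Mat m))
  else 0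

/-- Quantum relative entropy `K(S₁‖S₂) = tr(S₁ log S₁ - S₁ log S₂)`; the convention
`0 log 0 = 0` is automatic since `Real.log 0 = 0`. -/
def relEntropy (S₁ S₂ : Mat m) : ℝ :=
  (Matrix.trace (S₁ * hermApply Real.log S₁ - S₁ * hermApply Real.log S₂)).re

/-- Squared Bures distance `H²(S₁,S₂) = 2 - 2 tr √(√S₁ S₂ √S₁)`. -/
def bures2 (S₁ S₂ : Mat m) : ℝ :=
  2 - 2 * (Matrix.trace (hermApply Real.sqrt
      (hermApply Real.sqrt S₁ * S₂ * hermApply Real.sqrt S₁))).re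

/-- The probability simplex `Δ_m ⊂ ℝ^m`. -/
def simplex (m : ℕ) : Set (Fin m → ℝ) := {u | (∀ j, 0 ≤ u j) ∧ ∑ j, u j = 1}

/-- Euclidean norm on `ℝ^m`. -/
def e2 (x : Fin m → ℝ) : ℝ := Real.sqrt (∑ j, x j ^ 2)

/-- Supremum norm on `ℝ^m`. -/
def linf (x : Fin m → ℝ) : ℝ := ⨆ j, |x j|

/-- `v` is the Euclidean projection of `z` onto the simplex `Δ_m`. -/
def IsProjSimplex (z v : Fin m → ℝ) : Prop :=
  v ∈ simplex m ∧ ∀ u ∈ simplex m, e2 (z - v) ≤ e2 (z - u)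

/-- `E` is an orthonormal basis of the `m²`-dimensional real inner product space `ℍ_m`
of Hermitian `m×m` matrices (an orthonormal family of `m²` Hermitian matrices is
automatically a basis). -/
def IsONBasis (E : Fin (m ^ 2) → Mat m) : Prop :=
  (∀ k, (E k).IsHermitian) ∧
    ∀ k l, (Matrix.trace (E k * (E l)ᴴ)).re = if k = l then 1 else 0


lemma frob_nonneg (A : Mat m) : 0 ≤ frob A := Real.sqrt_nonneg _

lemma frob_sq (A : Mat m) : frob A ^ 2 = ∑ i, ∑ j, ‖A i j‖ ^ 2 :=
  Real.sq_sqrt (by positivity)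

lemma frob_sq_eq_trace (A : Mat m) : frob A ^ 2 = (Matrix.trace (A * Aᴴ)).re := by
  simp only [frob_sq, Matrix.trace, Matrix.diag_apply, Matrix.mul_apply,
    Matrix.conjTranspose_apply, Complex.re_sum]
  refine Finset.sum_congr rfl fun i _ => Finset.sum_congr rfl fun j _ => ?_
  rw [Complex.star_def, Complex.mul_conj, Complex.ofReal_re, Complex.normSq_eq_norm_sq]

lemma frob_parallelogram (A B : Mat m) :
    frob (A + B) ^ 2 + frob (A - B) ^ 2 = 2 * (frob A ^ 2 + frob B ^ 2) := by
  simp only [frob_sq, ← Finset.sum_add_distrib, Finset.mul_sum, Matrix.add_apply,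
    Matrix.sub_apply]
  refine Finset.sum_congr rfl fun i _ => Finset.sum_congr rfl fun j _ => ?_
  simpa only [sq] using parallelogram_law_with_norm ℝ (A i j) (B i j)

lemma frob_smul_sq (c : ℝ) (A : Mat m) : frob (c • A) ^ 2 = c ^ 2 * frob A ^ 2 := by
  simp [frob_sq, mul_pow, Finset.mul_sum]

lemma eq_zero_of_frob_sq_nonpos {A : Mat m} (h : frob A ^ 2 ≤ 0) : A = 0 := by
  rw [frob_sq] at h
  ext i j
  have hij : ‖A i j‖ ^ 2 ≤ ∑ i, ∑ j, ‖A i j‖ ^ 2 :=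
    (Finset.single_le_sum (f := fun j => ‖A i j‖ ^ 2) (fun _ _ => by positivity)
      (Finset.mem_univ j)).trans
      (Finset.single_le_sum (f := fun i => ∑ j, ‖A i j‖ ^ 2) (fun _ _ => by positivity)
        (Finset.mem_univ i))
  have h0 : ‖A i j‖ ^ 2 = 0 := le_antisymm (hij.trans h) (by positivity)
  simpa using h0

/-- The Hilbert–Schmidt projection onto a convex set is unique. -/
lemma IsProjOn.unique {C : Set (Mat m)} (hC : Convex ℝ C) {Z P Q : Mat m}
    (hP : IsProjOn C Z P) (hQ : IsProjOn C Z Q) : P = Q := by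
  set M : Mat m := (1 / 2 : ℝ) • P + (1 / 2 : ℝ) • Q with hM
  have hPM := hP.2 M (hC hP.1 hQ.1 (by norm_num) (by norm_num) (by norm_num))
  have hQP := hQ.2 P hP.1
  have hsum : (Z - P) + (Z - Q) = (2 : ℝ) • (Z - M) := by
    rw [hM]
    module
  have hpar := frob_parallelogram (Z - P) (Z - Q)
  rw [hsum, frob_smul_sq, sub_sub_sub_cancel_left] at hpar
  have h₁ := pow_le_pow_left₀ (frob_nonneg _) hPM 2
  have h₂ := pow_le_pow_left₀ (frob_nonneg _) hQP 2
  exact (sub_eq_zero.1 (eq_zero_of_frob_sq_nonpos (by linarith))).symm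

lemma convex_densities : Convex ℝ (Densities m) := by
  rintro A ⟨hA, hA'⟩ B ⟨hB, hB'⟩ a b ha hb hab
  refine ⟨(hA.smul ha).add (hB.smul hb), ?_⟩
  rw [Matrix.trace_add, Matrix.trace_smul, Matrix.trace_smul, hA', hB', ← add_smul, hab, one_smul]

lemma frob_conjTranspose_mul_mul {U : Mat m} (hU : U * Uᴴ = 1) (A : Mat m) :
    frob (Uᴴ * A * U) = frob A := by
  rw [← sq_eq_sq₀ (frob_nonneg _) (frob_nonneg _), frob_sq_eq_trace, frob_sq_eq_trace]
  have h : (Uᴴ * A * U) * (Uᴴ * A * U)ᴴ = Uᴴ * (A * (U * Uᴴ) * Aᴴ * U) := by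
    simp only [Matrix.conjTranspose_mul, Matrix.conjTranspose_conjTranspose, Matrix.mul_assoc]
  rw [h, Matrix.trace_mul_comm, hU, Matrix.mul_one, Matrix.mul_assoc, hU, Matrix.mul_one]

lemma IsDensity.conjTranspose_mul_mul {U : Mat m} (hU : U * Uᴴ = 1) {A : Mat m}
    (hA : IsDensity A) : IsDensity (Uᴴ * A * U) := by
  refine ⟨hA.1.conjTranspose_mul_mul_same U, ?_⟩
  rw [Matrix.mul_assoc, Matrix.trace_mul_comm, Matrix.mul_assoc, hU, Matrix.mul_one, hA.2]

/-- Conjugation by a unitary matrix carries projections onto the density matrices to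
projections onto the density matrices. -/
lemma IsProjOn.conjTranspose_mul_mul {U : Mat m} (hU : U * Uᴴ = 1) {Z P : Mat m}
    (hP : IsProjOn (Densities m) Z P) :
    IsProjOn (Densities m) (Uᴴ * Z * U) (Uᴴ * P * U) := by
  have hU' : Uᴴ * U = 1 := mul_eq_one_comm.1 hU
  refine ⟨IsDensity.conjTranspose_mul_mul hU hP.1, fun S hS => ?_⟩
  have hS' : IsDensity (U * S * Uᴴ) := by
    simpa using IsDensity.conjTranspose_mul_mul (U := Uᴴ) (by simpa using hU') hS
  have hconj : Uᴴ * (U * S * Uᴴ) * U = S := by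
    rw [Matrix.mul_assoc U, ← Matrix.mul_assoc, hU', Matrix.one_mul, Matrix.mul_assoc, hU',
      Matrix.mul_one]
  calc frob (Uᴴ * Z * U - Uᴴ * P * U) = frob (Z - P) := by
        rw [← Matrix.sub_mul, ← Matrix.mul_sub, frob_conjTranspose_mul_mul hU]
    _ ≤ frob (Z - U * S * Uᴴ) := hP.2 _ hS'
    _ = frob (Uᴴ * Z * U - S) := by
        rw [← frob_conjTranspose_mul_mul hU, Matrix.mul_sub, Matrix.sub_mul, hconj]

/-- Unitary equivariance of the Hilbert–Schmidt projection onto the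
density matrices: `π_{𝒮_m}(U⁻¹ Z U) = U⁻¹ π_{𝒮_m}(Z) U`. -/
theorem stmt9 {m : ℕ} (U : Mat m) (hU : U ∈ Matrix.unitaryGroup (Fin m) ℂ)
    (Z : Mat m) (hZ : Z.IsHermitian)
    (P : Mat m) (hP : IsProjOn (Densities m) Z P)
    (Q : Mat m) (hQ : IsProjOn (Densities m) (U⁻¹ * Z * U) Q) :
    Q = U⁻¹ * P * U := by
  have hUU : U * Uᴴ = 1 := Matrix.mem_unitaryGroup_iff.1 hU
  rw [Matrix.inv_eq_right_inv hUU] at hQ ⊢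
  exact hQ.unique convex_densities (hP.conjTranspose_mul_mul hUU)

end QST
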